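/- Let f, g, f', g' : M → N be continuous maps between topological spaces. If f is homotopic to f' and g is homotopic to g', then the homotopy equalizers Hoeq(f,g) and Hoeq(f',g') are homotopy equivalent topological spaces. -/

import Mathlib

open unitInterval

/-- The homotopy equalizer of `f, g : M → N`. -/
abbrev Hoeq {M N : Type*} [TopologicalSpace M] [TopologicalSpace N] (f g : M → N) :=
  {p : M × C(I, N) // p.2 0 = f p.1 ∧ p.2 1 = g p.1}

namespace Hoeq

variable {M N : Type*} [TopologicalSpace M] [TopologicalSpace N]

/-- Move from `s` towards `t` for time `w`, stopping at `t`. -/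
noncomputable def moveTowards (s t : I) (w : ℝ) : I :=
  Set.projIcc 0 1 zero_le_one (max (s - w) (min (s + w) t))

@[fun_prop]
lemma continuous_moveTowards {X : Type*} [TopologicalSpace X] {s t : X → I} {w : X → ℝ}
    (hs : Continuous s) (ht : Continuous t) (hw : Continuous w) :
    Continuous fun x ↦ moveTowards (s x) (t x) (w x) := by
  unfold moveTowards
  exact continuous_projIcc.comp (by fun_prop)

lemma moveTowards_zero (s t : I) : moveTowards s t 0 = s := by
  simp [moveTowards]

lemma moveTowards_dist (s t : I) : moveTowards s t |(t : ℝ) - s| = t := by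
  have h : max ((s : ℝ) - |(t : ℝ) - s|) (min (s + |(t : ℝ) - s|) t) = t := by
    rcases le_total (s : ℝ) t with h | h
    · rw [abs_of_nonneg (by linarith), min_eq_right (by linarith), max_eq_right (by linarith)]
    · rw [abs_of_nonpos (by linarith), min_eq_right (by linarith)]
      simp
  simp [moveTowards, h]

/-- The affine reparametrization of `[0, 1]` onto `[-d, 1 + d]`, where `d` is the distance
between `s` and `t`. -/
noncomputable def stretch (s t u : I) : ℝ :=
  u * (1 + 2 * |(t : ℝ) - s|) - |(t : ℝ) - s|

/-- Transport of a path from `F (s, x)` to `G (s, x)` to a path from `F (t, x)` to `G (t, x)`: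
conjugate it with the tracks of `x` under `F` and `G`. -/
noncomputable def transportFun (F G : C(I × M, N)) (t : I) (e : Hoeq F G) (u : I) : N :=
  if stretch e.1.1.1 t u ≤ 0 then F (moveTowards e.1.1.1 t (-stretch e.1.1.1 t u), e.1.1.2)
  else if stretch e.1.1.1 t u ≤ 1 then e.1.2 (Set.projIcc 0 1 zero_le_one (stretch e.1.1.1 t u))
  else G (moveTowards e.1.1.1 t (stretch e.1.1.1 t u - 1), e.1.1.2)

lemma continuous_transportFun (F G : C(I × M, N)) :
    Continuous fun p : (I × Hoeq F G) × I ↦ transportFun F G p.1.1 p.1.2 p.2 := by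
  have hv : Continuous fun p : (I × Hoeq F G) × I ↦ stretch p.1.2.1.1.1 p.1.1 p.2 := by
    unfold stretch
    fun_prop
  unfold transportFun
  refine Continuous.if_le (by fun_prop) (Continuous.if_le ?_ (by fun_prop) hv continuous_const ?_)
    hv continuous_const ?_
  · have := continuous_projIcc (h := zero_le_one (α := ℝ)).comp hv
    exact Continuous.eval (by fun_prop) this
  · rintro p hp
    simp [hp, moveTowards_zero, p.1.2.2.2]
  · rintro p hp
    simp [hp, moveTowards_zero, p.1.2.2.1]

lemma transportFun_zero (F G : C(I × M, N)) (t : I) (e : Hoeq F G) :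
    transportFun F G t e 0 = F (t, e.1.1.2) := by
  simp [transportFun, stretch, moveTowards_dist]

lemma transportFun_one (F G : C(I × M, N)) (t : I) (e : Hoeq F G) :
    transportFun F G t e 1 = G (t, e.1.1.2) := by
  have h : stretch e.1.1.1 t 1 = 1 + |(t : ℝ) - e.1.1.1| := by
    simp only [stretch, Set.Icc.coe_one]
    ring
  have hd := abs_nonneg ((t : ℝ) - e.1.1.1)
  unfold transportFun
  rw [h, if_neg (by linarith)]
  split_ifs with h1
  · have h0 : |(t : ℝ) - e.1.1.1| = 0 := by linarith
    have hts : t = e.1.1.1 := Subtype.ext (by linarith [abs_eq_zero.mp h0])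
    simp [e.2.2, hts]
  · simp [moveTowards_dist]

lemma transportFun_self (F G : C(I × M, N)) (e : Hoeq F G) (u : I) :
    transportFun F G e.1.1.1 e u = e.1.2 u := by
  have h : stretch e.1.1.1 e.1.1.1 u = u := by simp [stretch]
  unfold transportFun
  rw [h, if_pos u.2.2, Set.projIcc_val]
  split_ifs with h0
  · obtain rfl : u = 0 := Subtype.ext (le_antisymm h0 u.2.1)
    simp [moveTowards_zero, e.2.1]
  · rfl

/-- Parallel transport in the family of homotopy equalizers of `F (t, ·)` and `G (t, ·)`, whose
total space is the homotopy equalizer of `F` and `G`. -/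
noncomputable def transport (F G : C(I × M, N)) : C(I × Hoeq F G, Hoeq F G) where
  toFun p := ⟨((p.1, p.2.1.1.2),
      ⟨transportFun F G p.1 p.2,
        (continuous_transportFun F G).comp (Continuous.prodMk_right p)⟩),
    transportFun_zero F G p.1 p.2, transportFun_one F G p.1 p.2⟩
  continuous_toFun := by
    refine Continuous.subtype_mk (Continuous.prodMk (by fun_prop) ?_) _
    exact ContinuousMap.continuous_of_continuous_uncurry _ (continuous_transportFun F G)

lemma transport_self (F G : C(I × M, N)) (e : Hoeq F G) : transport F G (e.1.1.1, e) = e :=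
  Subtype.ext (Prod.ext rfl (ContinuousMap.ext (transportFun_self F G e)))

/-- The inclusion of a fibre into the total space. -/
def fibreIncl (F G : C(I × M, N)) (a : I) : C(Hoeq (F.curry a) (G.curry a), Hoeq F G) where
  toFun p := ⟨((a, p.1.1), p.1.2), p.2⟩
  continuous_toFun := by fun_prop

/-- Transport to the fibre over `a`. -/
noncomputable def toFibre (F G : C(I × M, N)) (a : I) :
    C(Hoeq F G, Hoeq (F.curry a) (G.curry a)) where
  toFun e := ⟨(e.1.1.2, (transport F G (a, e)).1.2), (transport F G (a, e)).2⟩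
  continuous_toFun := by
    have h : Continuous fun e ↦ transport F G (a, e) := by fun_prop
    exact Continuous.subtype_mk (Continuous.prodMk (by fun_prop)
      (continuous_snd.comp (continuous_subtype_val.comp h))) _

lemma fibreIncl_toFibre (F G : C(I × M, N)) (a : I) (e : Hoeq F G) :
    fibreIncl F G a (toFibre F G a e) = transport F G (a, e) := rfl

lemma toFibre_fibreIncl (F G : C(I × M, N)) (a : I) (p : Hoeq (F.curry a) (G.curry a)) :
    toFibre F G a (fibreIncl F G a p) = p :=
  Subtype.ext (Prod.ext rfl (ContinuousMap.ext (transportFun_self F G (fibreIncl F G a p))))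

/-- Transport from the fibre over `a` to the fibre over `b`. -/
noncomputable def fibreMap (F G : C(I × M, N)) (a b : I) :
    C(Hoeq (F.curry a) (G.curry a), Hoeq (F.curry b) (G.curry b)) :=
  (toFibre F G b).comp (fibreIncl F G a)

lemma fibreMap_comp_homotopic_id (F G : C(I × M, N)) (a b : I) :
    ((fibreMap F G b a).comp (fibreMap F G a b)).Homotopic (ContinuousMap.id _) := by
  have : PathConnectedSpace I := isPathConnected_iff_pathConnectedSpace.mp
    ((convex_Icc (0 : ℝ) 1).isPathConnected ⟨0, by simp⟩)
  obtain ⟨γ⟩ := PathConnectedSpace.joined b a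
  refine ⟨⟨⟨fun p ↦ toFibre F G a (transport F G (γ p.1, fibreIncl F G a p.2)), by fun_prop⟩,
    fun p ↦ ?_, fun p ↦ ?_⟩⟩
  · simp [fibreMap, fibreIncl_toFibre]
  · have h := transport_self F G (fibreIncl F G a p)
    change transport F G (a, _) = _ at h
    simp [h, toFibre_fibreIncl]

/-- Any two fibres are homotopy equivalent. -/
noncomputable def fibreHomotopyEquiv (F G : C(I × M, N)) (a b : I) :
    ContinuousMap.HomotopyEquiv (Hoeq (F.curry a) (G.curry a)) (Hoeq (F.curry b) (G.curry b)) where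
  toFun := fibreMap F G a b
  invFun := fibreMap F G b a
  left_inv := fibreMap_comp_homotopic_id F G a b
  right_inv := fibreMap_comp_homotopic_id F G b a

end Hoeq

/-- if `f ≃ f'` and `g ≃ g'` (homotopic), then `Hoeq(f,g)` and
`Hoeq(f',g')` are homotopy equivalent. -/
theorem statement3 {M N : Type*} [TopologicalSpace M] [TopologicalSpace N]
    (f g f' g' : C(M, N)) (hf : f.Homotopic f') (hg : g.Homotopic g') :
    Nonempty (ContinuousMap.HomotopyEquiv (Hoeq f g) (Hoeq f' g')) := by
  obtain ⟨F⟩ := hf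
  obtain ⟨G⟩ := hg
  have e := Hoeq.fibreHomotopyEquiv F.toContinuousMap G.toContinuousMap 0 1
  have hf₀ : F.toContinuousMap.curry 0 = f := by ext; simp
  have hf₁ : F.toContinuousMap.curry 1 = f' := by ext; simp
  have hg₀ : G.toContinuousMap.curry 0 = g := by ext; simp
  have hg₁ : G.toContinuousMap.curry 1 = g' := by ext; simp
  rw [hf₀, hf₁, hg₀, hg₁] at e
  exact ⟨e⟩
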